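/- arXiv:2112.06581 — 7 statements merged into one kernel-verified Lean document; each statement's English description precedes it below -/
import Mathlib

section
/- For all integers a, b > 1 and every positive integer μ with gcd(a−1, μ) = 1 and gcd(b−1, μ) = 1, the integer sequence n ↦ T(K_n; a, b) is ultimately periodic modulo μ. -/
open Finset

/-- A sequence of integers is ultimately periodic modulo `μ`. -/
def UltimatelyPeriodicMod (μ : ℕ) (f : ℕ → ℤ) : Prop :=
  ∃ N p : ℕ, 0 < p ∧ ∀ n : ℕ, N ≤ n → f (n + p) ≡ f n [ZMOD (μ : ℤ)]

/-- `kappa n A` is the number of connected components of the spanning subgraph of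
the complete graph on `Fin n` with edge set `A`. -/
noncomputable def kappa (n : ℕ) (A : Finset (Sym2 (Fin n))) : ℕ :=
  Nat.card (SimpleGraph.fromEdgeSet (↑A : Set (Sym2 (Fin n)))).ConnectedComponent

/-- The Tutte polynomial of the complete graph `K_n` evaluated at integers `(a, b)`:
`T(K_n; a, b) = Σ_{A ⊆ E(K_n)} (a-1)^(κ(A)-κ(E)) (b-1)^(|A|+κ(A)-n)`. -/
noncomputable def tutteK (n : ℕ) (a b : ℤ) : ℤ :=
  ∑ A ∈ (⊤ : SimpleGraph (Fin n)).edgeFinset.powerset,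
    (a - 1) ^ (kappa n A - kappa n (⊤ : SimpleGraph (Fin n)).edgeFinset) *
      (b - 1) ^ (A.card + kappa n A - n)

/-- A sequence obtained by iterating a self-map of a finite type is ultimately periodic. -/
theorem exists_iterate_add_eq {α : Type*} [Finite α] (f : α → α) (x : α) :
    ∃ N p : ℕ, 0 < p ∧ ∀ n : ℕ, N ≤ n → f^[n + p] x = f^[n] x := by
  obtain ⟨i, j, hij, h⟩ := Finite.exists_ne_map_eq_of_infinite (fun n : ℕ => f^[n] x)
  wlog hlt : i < j generalizing i j
  · exact this j i hij.symm h.symm (by omega)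
  refine ⟨i, j - i, by omega, fun n hn => ?_⟩
  obtain ⟨k, rfl⟩ := Nat.exists_eq_add_of_le hn
  rw [show i + k + (j - i) = k + j by omega, add_comm i k, Function.iterate_add_apply,
    Function.iterate_add_apply]
  exact congrArg _ h.symm

/-- The transfer operator which adds one vertex to the partition function of the `q`-state
Potts model on a complete graph with vertex activities `t`. -/
def pottsStep {R : Type*} [CommRing R] {q : ℕ} (b : R) (F : (Fin q → R) → R)
    (t : Fin q → R) : R :=
  ∑ c, t c * F (Function.update t c (b * t c))

theorem iterate_pottsStep {R : Type*} [CommRing R] {q : ℕ} (b : R) (n : ℕ) (t : Fin q → R) :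
    (pottsStep b)^[n] (fun _ => 1) t =
      ∑ σ : Fin n → Fin q,
        (∏ i, ∏ j, if i < j ∧ σ i = σ j then b else 1) * ∏ i, t (σ i) := by
  induction n generalizing t with
  | zero => simp
  | succ n ih =>
    rw [Function.iterate_succ_apply', pottsStep,
      ← (Fin.consEquiv fun _ : Fin (n + 1) => Fin q).sum_comp, Fintype.sum_prod_type]
    refine Finset.sum_congr rfl fun c _ => ?_
    rw [ih, Finset.mul_sum]
    refine Finset.sum_congr rfl fun σ _ => ?_
    have hupd (i : Fin n) : Function.update t c (b * t c) (σ i) =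
        (if c = σ i then b else 1) * t (σ i) := by
      by_cases h : c = σ i
      · simp [← h]
      · simp [h, Ne.symm h]
    simp only [hupd, Finset.prod_mul_distrib, Fin.prod_univ_succ, Fin.consEquiv_apply,
      Fin.cons_zero, Fin.cons_succ, Fin.succ_lt_succ_iff, Fin.succ_pos,
      Fin.not_lt_zero, false_and, true_and, if_false, one_mul]
    ring

/-- Colourings of the vertices that are constant on every edge of `A` correspond to colourings
of the connected components of `A`. -/
def monochromaticEquiv {V : Type*} (A : Set (Sym2 V)) (C : Type*) :
    {σ : V → C // ∀ e ∈ A, (e.map σ).IsDiag} ≃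
      ((SimpleGraph.fromEdgeSet A).ConnectedComponent → C) where
  toFun σ := fun K => K.lift σ.1 fun v w p hp => by
    clear hp
    induction p with
    | nil => rfl
    | cons h _ ih =>
      have hd : _ = _ := σ.2 _ ((SimpleGraph.fromEdgeSet_adj A).1 h).1
      exact hd.trans ih
  invFun τ := ⟨fun v => τ ((SimpleGraph.fromEdgeSet A).connectedComponentMk v), by
    rintro ⟨x, y⟩ he
    by_cases hxy : x = y
    · subst hxy; rfl
    · exact congrArg τ (SimpleGraph.ConnectedComponent.connectedComponentMk_eq_of_adj
        ((SimpleGraph.fromEdgeSet_adj A).2 ⟨he, hxy⟩))⟩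
  left_inv σ := rfl
  right_inv τ := by
    funext K
    induction K using SimpleGraph.ConnectedComponent.ind
    rfl

theorem card_monochromatic {n : ℕ} (A : Finset (Sym2 (Fin n))) (C : Type*) [Finite C] :
    Nat.card {σ : Fin n → C // ∀ e ∈ A, (e.map σ).IsDiag} = Nat.card C ^ kappa n A := by
  rw [kappa, ← Nat.card_fun]
  exact Nat.card_congr (monochromaticEquiv (A : Set (Sym2 (Fin n))) C)

theorem le_card_add_kappa {n : ℕ} (A : Finset (Sym2 (Fin n))) : n ≤ A.card + kappa n A := by
  let f : (Fin n → ZMod 2) →+ (A → ZMod 2) :=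
    { toFun := fun σ e => Sym2.lift ⟨fun x y => σ x + σ y, fun x y => add_comm _ _⟩ e.1
      map_zero' := by
        funext ⟨e, he⟩
        induction e
        simp
      map_add' := fun σ τ => by
        funext ⟨e, he⟩
        induction e
        simp only [Sym2.lift_mk, Pi.add_apply]
        ring }
  have hker : Nat.card f.ker = 2 ^ kappa n A := by
    refine Eq.trans ?_ ((card_monochromatic A (ZMod 2)).trans (by rw [Nat.card_zmod]))
    refine Nat.card_congr (Equiv.subtypeEquivRight fun σ => ?_)
    rw [AddMonoidHom.mem_ker, funext_iff, Subtype.forall]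
    refine forall₂_congr fun e he => ?_
    induction e
    exact CharTwo.add_eq_zero
  have hcard := f.ker.card_mul_index
  rw [AddSubgroup.index_ker, hker, Nat.card_fun, Nat.card_zmod, Nat.card_fin] at hcard
  have hrange : Nat.card f.range ≤ 2 ^ A.card := by
    simpa [Nat.card_fun] using Nat.card_le_card_of_injective _ (Subtype.val_injective (p := (· ∈ f.range)))
  refine (Nat.pow_le_pow_iff_right one_lt_two).1 ?_
  rw [← hcard, pow_add, mul_comm]
  exact Nat.mul_le_mul_right _ hrange

theorem prod_edgeFinset_top {M : Type*} [CommMonoid M] {n : ℕ} (p : Sym2 (Fin n) → M) :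
    ∏ e ∈ (⊤ : SimpleGraph (Fin n)).edgeFinset, p e =
      ∏ i, ∏ j, if i < j then p s(i, j) else 1 := by
  have h := Finset.sum_sym2_filter_not_isDiag (M := Additive M) Finset.univ
    fun e : Sym2 (Fin n) => Additive.ofMul (p e)
  have h' : ∏ e ∈ Finset.univ.sym2 with ¬ e.IsDiag, p e =
      ∏ i ∈ (Finset.univ : Finset (Fin n)).offDiag with i.1 < i.2, p s(i.1, i.2) := h
  rw [← Fintype.prod_prod_type' fun i j => if i < j then p s(i, j) else 1, ← Finset.prod_filter]
  convert h' using 2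
  · ext e
    induction e
    simp
  · ext ⟨i, j⟩
    simpa using fun h : i < j => h.ne

/-- The Fortuin–Kasteleyn expansion of the Potts partition function of `K_n`. -/
theorem sum_powerset_pow_kappa {R : Type*} [CommRing R] (n q : ℕ) (w : R) :
    ∑ A ∈ (⊤ : SimpleGraph (Fin n)).edgeFinset.powerset, w ^ A.card * (q : R) ^ kappa n A =
      ∑ σ : Fin n → Fin q, ∏ i, ∏ j, if i < j ∧ σ i = σ j then w + 1 else 1 := by
  classical
  have hq (A : Finset (Sym2 (Fin n))) : (q : R) ^ kappa n A =
      ∑ σ : Fin n → Fin q, if ∀ e ∈ A, (e.map σ).IsDiag then 1 else 0 := by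
    rw [Finset.sum_boole, ← Fintype.card_subtype, ← Nat.card_eq_fintype_card,
      card_monochromatic, Nat.card_fin, Nat.cast_pow]
  simp_rw [hq, Finset.mul_sum]
  rw [Finset.sum_comm]
  refine Finset.sum_congr rfl fun σ _ => ?_
  calc _ = ∑ A ∈ (⊤ : SimpleGraph (Fin n)).edgeFinset.powerset,
          ∏ e ∈ A, if (e.map σ).IsDiag then w else 0 := by
        refine Finset.sum_congr rfl fun A _ => ?_
        split_ifs with h
        · rw [mul_one, Finset.prod_congr rfl fun e he => if_pos (h e he), Finset.prod_const]
        · push Not at h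
          obtain ⟨e, he, hd⟩ := h
          rw [mul_zero, Finset.prod_eq_zero he (if_neg hd)]
    _ = _ := by
        rw [← Finset.prod_add_one, prod_edgeFinset_top]
        refine Finset.prod_congr rfl fun i _ => Finset.prod_congr rfl fun j _ => ?_
        by_cases h : i < j <;> by_cases h' : σ i = σ j <;> simp [h, h']

theorem kappa_top {n : ℕ} (hn : 0 < n) :
    kappa n (⊤ : SimpleGraph (Fin n)).edgeFinset = 1 := by
  have : Nonempty (Fin n) := ⟨⟨0, hn⟩⟩
  rw [kappa, SimpleGraph.coe_edgeFinset, SimpleGraph.fromEdgeSet_edgeSet]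
  have := (SimpleGraph.connected_top (V := Fin n)).preconnected.subsingleton_connectedComponent
  exact Nat.card_unique

theorem kappa_pos {n : ℕ} (hn : 0 < n) (A : Finset (Sym2 (Fin n))) : 0 < kappa n A := by
  have : Nonempty (SimpleGraph.fromEdgeSet (A : Set (Sym2 (Fin n)))).ConnectedComponent :=
    ⟨SimpleGraph.connectedComponentMk _ ⟨0, hn⟩⟩
  exact Nat.card_pos

theorem mul_tutteK {n : ℕ} (hn : 0 < n) (a b : ℤ) :
    (a - 1) * (b - 1) ^ n * tutteK n a b =
      ∑ A ∈ (⊤ : SimpleGraph (Fin n)).edgeFinset.powerset,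
        (b - 1) ^ A.card * ((a - 1) * (b - 1)) ^ kappa n A := by
  rw [tutteK, Finset.mul_sum, kappa_top hn]
  refine Finset.sum_congr rfl fun A _ => ?_
  obtain ⟨k, hk⟩ := Nat.exists_eq_add_of_le (kappa_pos hn A)
  obtain ⟨m, hm⟩ := Nat.exists_eq_add_of_le (le_card_add_kappa A)
  have hb : (b - 1) ^ n * (b - 1) ^ m = (b - 1) ^ A.card * (b - 1) ^ kappa n A := by
    rw [← pow_add, ← pow_add, hm]
  rw [hm, Nat.add_sub_cancel_left, mul_pow, mul_left_comm ((b - 1) ^ A.card), ← hb, hk,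
    Nat.succ_eq_add_one, zero_add, Nat.add_sub_cancel_left]
  ring

theorem isUnit_intCast_zmod {μ : ℕ} {x : ℤ} (h : Int.gcd x μ = 1) : IsUnit (x : ZMod μ) := by
  obtain ⟨u, v, huv⟩ := Int.isCoprime_iff_gcd_eq_one.2 h
  refine IsUnit.of_mul_eq_one_right (u : ZMod μ) ?_
  simpa using congrArg (Int.cast : ℤ → ZMod μ) huv

/-- Modulo `μ`, the values `T(K_n; a, b)` are read off from iterates of `pottsStep`. -/
theorem tutteK_cast_eq {a b : ℤ} (ha : 1 < a) (hb : 1 < b) {μ : ℕ} (u w : (ZMod μ)ˣ)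
    (hu : (u : ZMod μ) = (a - 1 : ℤ)) (hw : (w : ZMod μ) = (b - 1 : ℤ)) {n : ℕ} (hn : 0 < n) :
    (tutteK n a b : ZMod μ) = ↑u⁻¹ *
      (pottsStep (q := ((a - 1) * (b - 1)).toNat) (b : ZMod μ))^[n] (fun _ => 1)
        fun _ => ↑w⁻¹ := by
  set q := ((a - 1) * (b - 1)).toNat with hq
  have hq' : (q : ℤ) = (a - 1) * (b - 1) := by
    rw [hq, Int.toNat_of_nonneg]
    exact mul_nonneg (by omega) (by omega)
  have h := congrArg (Int.cast : ℤ → ZMod μ) (mul_tutteK hn a b)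
  rw [← hq'] at h
  push_cast at h hu hw
  rw [← hu, ← hw, sum_powerset_pow_kappa] at h
  rw [iterate_pottsStep]
  simp only [Finset.prod_const, Finset.card_univ, Fintype.card_fin]
  rw [← Finset.sum_mul]
  rw [hw, sub_add_cancel, ← hw] at h
  rw [← h, Units.eq_inv_mul_iff_mul_eq, ← Units.val_pow_eq_pow_val, ← Units.val_pow_eq_pow_val,
    inv_pow, Units.eq_mul_inv_iff_mul_eq]
  ring

theorem tutteK_ultimately_periodic_mod
    (a b : ℤ) (ha : 1 < a) (hb : 1 < b) (μ : ℕ) (hμ : 0 < μ)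
    (hga : Int.gcd (a - 1) (μ : ℤ) = 1) (hgb : Int.gcd (b - 1) (μ : ℤ) = 1) :
    UltimatelyPeriodicMod μ (fun n => tutteK n a b) := by
  have : NeZero μ := ⟨hμ.ne'⟩
  obtain ⟨u, hu⟩ := isUnit_intCast_zmod hga
  obtain ⟨w, hw⟩ := isUnit_intCast_zmod hgb
  obtain ⟨N, p, hp, h⟩ := exists_iterate_add_eq
    (pottsStep (q := ((a - 1) * (b - 1)).toNat) (b : ZMod μ)) fun _ => 1
  refine ⟨N + 1, p, hp, fun n hn => (ZMod.intCast_eq_intCast_iff _ _ _).1 ?_⟩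
  rw [tutteK_cast_eq ha hb u w hu hw (by omega), tutteK_cast_eq ha hb u w hu hw (by omega),
    h n (by omega)]
end

section
/- For all positive integers a, b, μ, the integer sequence n ↦ M̄(K_n; a, b) = Σ_{k=0}^{⌊n/2⌋} m_k(K_n) · a^k · b^{n−2k} is ultimately periodic modulo μ. -/
open Finset

/-- `matchK n k` is the number of matchings of size `k` in the complete graph on `Fin n`:
sets of `k` pairwise (vertex-)disjoint edges. -/
def matchK (n k : ℕ) : ℕ :=
  (((⊤ : SimpleGraph (Fin n)).edgeFinset.powerset.filter
    (fun A => A.card = k ∧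
      ∀ e ∈ A, ∀ f ∈ A, e ≠ f → ∀ v : Fin n, ¬(v ∈ e ∧ v ∈ f))).card)

/-- The bivariate matching polynomial of `K_n` evaluated at `(a, b)`:
`M̄(K_n; a, b) = Σ_{k=0}^{⌊n/2⌋} m_k(K_n) a^k b^(n-2k)`. -/
def matchPolyBar (n : ℕ) (a b : ℤ) : ℤ :=
  ∑ k ∈ Finset.range (n / 2 + 1), (matchK n k : ℤ) * a ^ k * b ^ (n - 2 * k)

/-- `A` is a matching of the complete graph on the vertex set `S`. -/
def IsMatchingOn {V : Type*} (S : Finset V) (A : Finset (Sym2 V)) : Prop :=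
  (∀ e ∈ A, ¬ e.IsDiag ∧ ∀ v ∈ e, v ∈ S) ∧
    ∀ e ∈ A, ∀ f ∈ A, e ≠ f → ∀ v : V, ¬(v ∈ e ∧ v ∈ f)

open Classical in
/-- The matchings of size `k` of the complete graph on the vertex set `S`. -/
noncomputable def matchingsOn {V : Type*} [Fintype V] (S : Finset V) (k : ℕ) :
    Finset (Finset (Sym2 V)) :=
  Finset.univ.filter fun A => A.card = k ∧ IsMatchingOn S A

/-- The number of `k`-matchings of a complete graph on `n` vertices, defined by recursion on the
edge covering the last vertex. -/
def matchRec : ℕ → ℕ → ℕ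
  | _, 0 => 1
  | 0, _ + 1 => 0
  | 1, _ + 1 => 0
  | n + 2, k + 1 => matchRec (n + 1) (k + 1) + (n + 1) * matchRec n k

section Matchings

variable {V : Type*}

theorem mem_matchingsOn [Fintype V] {S : Finset V} {k : ℕ} {A : Finset (Sym2 V)} :
    A ∈ matchingsOn S k ↔ A.card = k ∧ IsMatchingOn S A := by
  simp [matchingsOn]

theorem IsMatchingOn.notMem_of_mem {S : Finset V} {A : Finset (Sym2 V)} (h : IsMatchingOn S A)
    {v : V} (hv : v ∉ S) (u : V) : s(v, u) ∉ A :=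
  fun hA => hv ((h.1 _ hA).2 v (Sym2.mem_mk_left v u))

theorem IsMatchingOn.mono {S T : Finset V} (hST : S ⊆ T) {A : Finset (Sym2 V)}
    (h : IsMatchingOn S A) : IsMatchingOn T A :=
  ⟨fun e he => ⟨(h.1 e he).1, fun v hv => hST ((h.1 e he).2 v hv)⟩, h.2⟩

theorem matchingsOn_zero [Fintype V] (S : Finset V) : matchingsOn S 0 = {∅} := by
  ext A
  rw [mem_matchingsOn, Finset.card_eq_zero, Finset.mem_singleton, and_iff_left_iff_imp]
  rintro rfl
  simp [IsMatchingOn]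

theorem matchingsOn_empty_succ [Fintype V] (k : ℕ) : matchingsOn (∅ : Finset V) (k + 1) = ∅ := by
  refine Finset.eq_empty_of_forall_notMem fun A hA => ?_
  obtain ⟨hc, h⟩ := mem_matchingsOn.1 hA
  obtain ⟨e, he⟩ := Finset.card_pos.1 (hc.symm ▸ Nat.succ_pos k : 0 < A.card)
  obtain ⟨x, hx⟩ : ∃ x, x ∈ e := ⟨_, e.out_fst_mem⟩
  exact Finset.notMem_empty x ((h.1 e he).2 x hx)

variable [DecidableEq V]

theorem IsMatchingOn.insert_edge {S : Finset V} {v u : V} (hv : v ∉ S) (hu : u ∈ S)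
    {A : Finset (Sym2 V)} (h : IsMatchingOn (S.erase u) A) :
    IsMatchingOn (insert v S) (insert s(v, u) A) := by
  have key : ∀ f ∈ A, ∀ w, w ∈ s(v, u) → w ∉ f := by
    intro f hf w hw hwf
    have := (h.1 f hf).2 w hwf
    rcases Sym2.mem_iff.1 hw with rfl | rfl
    · exact hv (Finset.mem_of_mem_erase this)
    · simp at this
  refine ⟨?_, ?_⟩
  · intro e he
    rcases Finset.mem_insert.1 he with rfl | he
    · refine ⟨?_, ?_⟩
      · rw [Sym2.mk_isDiag_iff]
        rintro rfl
        exact hv hu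
      · intro w hw
        rcases Sym2.mem_iff.1 hw with rfl | rfl
        · simp
        · simp [hu]
    · exact ⟨(h.1 e he).1, fun w hw =>
        Finset.mem_insert_of_mem (Finset.mem_of_mem_erase ((h.1 e he).2 w hw))⟩
  · intro e he f hf hef w hw
    rcases Finset.mem_insert.1 he with rfl | he <;> rcases Finset.mem_insert.1 hf with rfl | hf
    · exact hef rfl
    · exact key f hf w hw.1 hw.2
    · exact key e he w hw.2 hw.1
    · exact h.2 e he f hf hef w hw

theorem IsMatchingOn.erase_edge {S : Finset V} {v u : V}
    {A : Finset (Sym2 V)} (h : IsMatchingOn (insert v S) A) (hA : s(v, u) ∈ A) :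
    IsMatchingOn (S.erase u) (A.erase s(v, u)) := by
  refine ⟨?_, ?_⟩
  · intro e he
    obtain ⟨hne, he⟩ := Finset.mem_erase.1 he
    refine ⟨(h.1 e he).1, fun w hw => ?_⟩
    have hd := h.2 e he _ hA hne w
    have hwS := (h.1 e he).2 w hw
    rw [Sym2.mem_iff] at hd
    rw [Finset.mem_insert] at hwS
    rw [Finset.mem_erase]
    tauto
  · intro e he f hf
    exact h.2 e (Finset.mem_of_mem_erase he) f (Finset.mem_of_mem_erase hf)

variable [Fintype V]

theorem matchingsOn_insert {S : Finset V} {v : V} (hv : v ∉ S) (k : ℕ) :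
    matchingsOn (insert v S) (k + 1) = matchingsOn S (k + 1) ∪
      S.biUnion fun u => (matchingsOn (S.erase u) k).image (insert s(v, u)) := by
  ext A
  simp only [Finset.mem_union, Finset.mem_biUnion, Finset.mem_image, mem_matchingsOn]
  constructor
  · rintro ⟨hc, h⟩
    by_cases hcov : ∃ e ∈ A, v ∈ e
    · obtain ⟨e, he, hve⟩ := hcov
      obtain ⟨u, rfl⟩ := hve
      have h1 := h.1 _ he
      have huv : v ≠ u := by simpa using h1.1
      have hu : u ∈ S := by
        have := h1.2 u (Sym2.mem_mk_right v u)
        rw [Finset.mem_insert] at this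
        exact this.resolve_left huv.symm
      refine Or.inr ⟨u, hu, A.erase s(v, u), ⟨?_, h.erase_edge he⟩, Finset.insert_erase he⟩
      rw [Finset.card_erase_of_mem he, hc, Nat.add_sub_cancel]
    · push Not at hcov
      refine Or.inl ⟨hc, fun e he => ⟨(h.1 e he).1, fun w hw => ?_⟩, h.2⟩
      refine (Finset.mem_insert.1 ((h.1 e he).2 w hw)).resolve_left ?_
      rintro rfl
      exact hcov e he hw
  · rintro (⟨hc, h⟩ | ⟨u, hu, B, ⟨hc, h⟩, rfl⟩)
    · exact ⟨hc, h.mono (Finset.subset_insert v S)⟩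
    · refine ⟨?_, h.insert_edge hv hu⟩
      rw [Finset.card_insert_of_notMem, hc]
      exact h.notMem_of_mem (fun hm => hv (Finset.mem_of_mem_erase hm)) u

theorem card_matchingsOn_insert {S : Finset V} {v : V} (hv : v ∉ S) (k : ℕ) :
    (matchingsOn (insert v S) (k + 1)).card = (matchingsOn S (k + 1)).card +
      ∑ u ∈ S, (matchingsOn (S.erase u) k).card := by
  have hv' : ∀ u, v ∉ S.erase u := fun u hm => hv (Finset.mem_of_mem_erase hm)
  rw [matchingsOn_insert hv, Finset.card_union_of_disjoint, Finset.card_biUnion]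
  · congr 1
    refine Finset.sum_congr rfl fun u _ => Finset.card_image_of_injOn ?_
    intro A hA B hB hAB
    have hA' := (mem_matchingsOn.1 hA).2.notMem_of_mem (hv' u) u
    have hB' := (mem_matchingsOn.1 hB).2.notMem_of_mem (hv' u) u
    rw [← Finset.erase_insert hA', ← Finset.erase_insert hB']
    exact congrArg (fun C => Finset.erase C s(v, u)) hAB
  · intro u _ w _ huw
    refine Finset.disjoint_left.2 fun A hA hA' => ?_
    obtain ⟨B, hB, rfl⟩ := Finset.mem_image.1 hA
    obtain ⟨C, hC, hCB⟩ := Finset.mem_image.1 hA'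
    have hmem : s(v, w) ∈ insert s(v, u) B := hCB ▸ Finset.mem_insert_self _ _
    rcases Finset.mem_insert.1 hmem with h | h
    · exact huw (Sym2.congr_right.1 h).symm
    · exact (mem_matchingsOn.1 hB).2.notMem_of_mem (hv' u) w h
  · rw [Finset.disjoint_left]
    intro A hA hA'
    obtain ⟨u, _, hu⟩ := Finset.mem_biUnion.1 hA'
    obtain ⟨B, _, rfl⟩ := Finset.mem_image.1 hu
    exact (mem_matchingsOn.1 hA).2.notMem_of_mem hv u (Finset.mem_insert_self _ _)

theorem card_matchingsOn (n : ℕ) (S : Finset V) (hS : S.card = n) (k : ℕ) :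
    (matchingsOn S k).card = matchRec n k := by
  induction n using Nat.strong_induction_on generalizing S k with
  | _ n ih =>
    cases k with
    | zero => rw [matchingsOn_zero, Finset.card_singleton]; cases n <;> simp [matchRec]
    | succ k =>
      rcases S.eq_empty_or_nonempty with rfl | ⟨v, hvS⟩
      · subst hS
        rw [matchingsOn_empty_succ]
        simp [matchRec]
      · have hv : v ∉ S.erase v := Finset.notMem_erase v S
        have hT : (S.erase v).card + 1 = n := by rw [Finset.card_erase_add_one hvS, hS]
        rw [← Finset.insert_erase hvS, card_matchingsOn_insert hv]
        generalize S.erase v = T at *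
        match n, hT with
        | 1, hT =>
          have : T = ∅ := Finset.card_eq_zero.1 (by omega)
          subst this
          rw [matchingsOn_empty_succ]
          simp [matchRec]
        | m + 2, hT =>
          have hT : T.card = m + 1 := by omega
          rw [ih (m + 1) (by omega) T hT,
            Finset.sum_congr rfl fun u hu =>
              ih m (by omega) (T.erase u) (by rw [Finset.card_erase_of_mem hu]; omega) k]
          simp [matchRec, hT]

end Matchings

theorem matchK_eq_matchRec (n k : ℕ) : matchK n k = matchRec n k := by
  rw [← card_matchingsOn n (Finset.univ : Finset (Fin n)) (by simp) k, matchK]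
  congr 1
  ext A
  simp only [mem_matchingsOn, IsMatchingOn, Finset.mem_filter, Finset.mem_powerset,
    Finset.subset_iff, SimpleGraph.mem_edgeFinset, SimpleGraph.edgeSet_top, Finset.mem_univ,
    implies_true, and_true]
  simp only [Set.mem_compl_iff, Sym2.mem_diagSet]
  tauto

theorem matchRec_eq_zero (n k : ℕ) (h : n < 2 * k) : matchRec n k = 0 := by
  induction n using Nat.strong_induction_on generalizing k with
  | _ n ih =>
    match n, k with
    | _, 0 => omega
    | 0, k + 1 => rfl
    | 1, k + 1 => rfl
    | n + 2, k + 1 =>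
      rw [matchRec, ih (n + 1) (by omega) _ (by omega), ih n (by omega) _ (by omega), mul_zero, zero_add]

theorem matchPolyBar_eq_sum (n N : ℕ) (hN : n / 2 + 1 ≤ N) (a b : ℤ) :
    matchPolyBar n a b =
      ∑ k ∈ Finset.range N, (matchRec n k : ℤ) * a ^ k * b ^ (n - 2 * k) := by
  simp only [matchPolyBar, matchK_eq_matchRec]
  refine Finset.sum_subset (Finset.range_mono hN) fun k _ hk => ?_
  rw [Finset.mem_range] at hk
  rw [matchRec_eq_zero n k (by omega)]
  simp

theorem matchPolyBar_add_two (n : ℕ) (a b : ℤ) :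
    matchPolyBar (n + 2) a b =
      b * matchPolyBar (n + 1) a b + (n + 1) * a * matchPolyBar n a b := by
  rw [matchPolyBar_eq_sum (n + 2) (n / 2 + 1 + 1) (by omega),
    matchPolyBar_eq_sum (n + 1) (n / 2 + 1 + 1) (by omega),
    matchPolyBar_eq_sum n (n / 2 + 1) le_rfl, Finset.sum_range_succ',
    Finset.sum_range_succ' (fun k => (matchRec (n + 1) k : ℤ) * a ^ k * b ^ (n + 1 - 2 * k)),
    mul_add, Finset.mul_sum, Finset.mul_sum, add_right_comm, ← Finset.sum_add_distrib]
  congr 1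
  · refine Finset.sum_congr rfl fun k hk => ?_
    rw [Finset.mem_range] at hk
    rw [matchRec, show n + 2 - 2 * (k + 1) = n - 2 * k by omega]
    by_cases hkn : n = 2 * k
    · rw [matchRec_eq_zero (n + 1) (k + 1) (by omega)]
      push_cast
      ring
    · rw [show n - 2 * k = n + 1 - 2 * (k + 1) + 1 by omega]
      push_cast
      ring
  · simp [matchRec]
    ring

/-- An orbit of a self-map of a finite type is ultimately periodic. -/
theorem exists_period_of_finite {α : Type*} [Finite α] (T : α → α) (s : ℕ → α)
    (hs : ∀ n, s (n + 1) = T (s n)) :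
    ∃ N p : ℕ, 0 < p ∧ ∀ n, N ≤ n → s (n + p) = s n := by
  obtain ⟨i, j, hij, h⟩ := Finite.exists_ne_map_eq_of_infinite s
  wlog hlt : i < j generalizing i j
  · exact this j i hij.symm h.symm (by omega)
  refine ⟨i, j - i, by omega, fun n hn => ?_⟩
  induction n, hn using Nat.le_induction with
  | base => rw [Nat.add_sub_of_le hlt.le, h]
  | succ n _ ih => rw [add_right_comm, hs, hs, ih]

theorem matchPolyBar_ultimately_periodic_mod
    (a b : ℤ) (ha : 0 < a) (hb : 0 < b) (μ : ℕ) (hμ : 0 < μ) :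
    UltimatelyPeriodicMod μ (fun n => matchPolyBar n a b) := by
  have : NeZero μ := ⟨hμ.ne'⟩
  obtain ⟨N, p, hp, h⟩ := exists_period_of_finite
    (fun x : ZMod μ × ZMod μ × ZMod μ =>
      (x.1 + 1, x.2.2, (b : ZMod μ) * x.2.2 + (x.1 + 1) * a * x.2.1))
    (fun n => ((n : ZMod μ), (matchPolyBar n a b : ZMod μ),
      (matchPolyBar (n + 1) a b : ZMod μ)))
    (fun n => by
      simp only [matchPolyBar_add_two]
      push_cast
      rfl)
  refine ⟨N, p, hp, fun n hn => ?_⟩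
  rw [← ZMod.intCast_eq_intCast_iff]
  exact congrArg (fun x => x.2.1) (h n hn)
end

section
/- For all positive integers a, b, c, μ, the integer sequence n ↦ S(K_n; a, b, c) is ultimately periodic modulo μ. -/
open Finset

/-- `kappaSub n W F` is the number of connected components of the graph with
vertex set `W` and edge set `F` (isolated vertices count as components),
assuming all endpoints of edges of `F` lie in `W`. -/
noncomputable def kappaSub (n : ℕ) (W : Finset (Fin n)) (F : Finset (Sym2 (Fin n))) : ℕ :=
  Nat.card ((SimpleGraph.fromEdgeSet (↑F : Set (Sym2 (Fin n)))).induce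
    (↑W : Set (Fin n))).ConnectedComponent

/-- The subgraph counting polynomial of `K_n` evaluated at `(x, y, z)`:
`S(K_n; x, y, z) = Σ_{(W,F) subgraph of K_n} x^|W| y^κ(W,F) z^|F|`,
where `(W,F)` ranges over pairs with `W ⊆ V(K_n)`, `F ⊆ E(K_n)` and all
endpoints of edges of `F` in `W`. -/
noncomputable def subgraphCountK (n : ℕ) (x y z : ℤ) : ℤ :=
  ∑ W ∈ (Finset.univ : Finset (Fin n)).powerset,
    ∑ F ∈ (⊤ : SimpleGraph (Fin n)).edgeFinset.powerset.filter
        (fun F => ∀ e ∈ F, ∀ v : Fin n, v ∈ e → v ∈ W),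
      x ^ W.card * y ^ kappaSub n W F * z ^ F.card

/-- The number of positions at which the word `σ` takes each letter. -/
def letterCount {ι : Type*} [DecidableEq ι] {n : ℕ} (σ : Fin n → ι) (i : ι) : ℕ :=
  #{v | σ v = i}

theorem letterCount_cons {ι : Type*} [DecidableEq ι] {n : ℕ} (i : ι) (σ : Fin n → ι) :
    letterCount (Fin.cons i σ : Fin (n + 1) → ι) = letterCount σ + Pi.single i 1 := by
  funext j
  simp only [letterCount, Fin.card_filter_univ_succ, Fin.cons_zero, Fin.cons_succ, Pi.add_apply,
    Pi.single_apply, eq_comm (a := j)]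
  split_ifs <;> rfl

/-- The operator on functions of letter counts that sums over the ways to append one letter. -/
def appendLetter (ι R : Type*) [DecidableEq ι] [Fintype ι] [Semiring R] :
    ((ι → ℕ) → R) →ₗ[R] ((ι → ℕ) → R) where
  toFun ψ v := ∑ i, ψ (v + Pi.single i 1)
  map_add' ψ χ := by
    funext v
    simp [Finset.sum_add_distrib]
  map_smul' r ψ := by
    funext v
    simp [Finset.mul_sum]

theorem appendLetter_apply {ι R : Type*} [DecidableEq ι] [Fintype ι] [Semiring R]
    (ψ : (ι → ℕ) → R) (v : ι → ℕ) :
    appendLetter ι R ψ v = ∑ i, ψ (v + Pi.single i 1) := rfl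

theorem sum_words_letterCount {ι R : Type*} [DecidableEq ι] [Fintype ι] [Semiring R] (n : ℕ)
    (ψ : (ι → ℕ) → R) :
    ∑ σ : Fin n → ι, ψ (letterCount σ) = ((appendLetter ι R)^[n] ψ) 0 := by
  induction n generalizing ψ with
  | zero =>
    simp only [Finset.univ_unique, Finset.sum_singleton, Function.iterate_zero, id_eq]
    congr 1
  | succ n ih =>
    rw [Function.iterate_succ_apply, ← ih, ← (Fin.consEquiv fun _ => ι).sum_comp,
      Fintype.sum_prod_type, Finset.sum_comm]
    refine Finset.sum_congr rfl fun σ _ => ?_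
    rw [appendLetter_apply]
    refine Finset.sum_congr rfl fun i _ => ?_
    rw [← letterCount_cons]
    rfl

/-- A sequence in a finite set obtained by iterating a map is ultimately periodic. -/
theorem exists_iterate_add_eq_of_finite {α : Type*} (T : α → α) (s : Set α) (hs : s.Finite)
    (hT : ∀ x ∈ s, T x ∈ s) {x : α} (hx : x ∈ s) :
    ∃ N p : ℕ, 0 < p ∧ ∀ n, N ≤ n → T^[n + p] x = T^[n] x := by
  have hmem (n : ℕ) : T^[n] x ∈ s := by
    induction n with
    | zero => exact hx
    | succ n ih => rw [Function.iterate_succ_apply']; exact hT _ ih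
  obtain ⟨N, M, hNM, h⟩ : ∃ N M : ℕ, N < M ∧ T^[N] x = T^[M] x := by
    obtain ⟨N, -, M, -, hne, h⟩ := Set.infinite_univ.exists_ne_map_eq_of_mapsTo
      (f := fun n : ℕ => T^[n] x) (fun n _ => hmem n) hs
    rcases hne.lt_or_gt with h' | h'
    · exact ⟨N, M, h', h⟩
    · exact ⟨M, N, h', h.symm⟩
  refine ⟨N, M - N, by omega, fun n hn => ?_⟩
  rw [show n + (M - N) = (n - N) + M by omega, Function.iterate_add_apply, ← h,
    ← Function.iterate_add_apply, Nat.sub_add_cancel hn]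

/-- The weight `s * ∏ i, q i ^ v i * w ^ (v i choose 2)`, not depending on `v none`. -/
def quadWeight {κ R : Type*} [Fintype κ] [CommSemiring R] (w s : R) (q : κ → R)
    (v : Option κ → ℕ) : R :=
  s * ∏ i, q i ^ v (some i) * w ^ (v (some i)).choose 2

theorem quadWeight_add_single_none {κ R : Type*} [Fintype κ] [DecidableEq κ] [CommSemiring R]
    (w s : R) (q : κ → R) (v : Option κ → ℕ) :
    quadWeight w s q (v + Pi.single none 1) = quadWeight w s q v := by
  simp [quadWeight]

theorem quadWeight_add_single_some {κ R : Type*} [Fintype κ] [DecidableEq κ] [CommSemiring R]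
    (w s : R) (q : κ → R) (v : Option κ → ℕ) (j : κ) :
    quadWeight w s q (v + Pi.single (some j) 1) =
      quadWeight w (s * q j) (Function.update q j (q j * w)) v := by
  have key : ∏ i, q i ^ (v + Pi.single (some j) 1 : Option κ → ℕ) (some i) *
        w ^ ((v + Pi.single (some j) 1 : Option κ → ℕ) (some i)).choose 2 =
      ∏ i, (if i = j then q j else 1) *
        (Function.update q j (q j * w) i ^ v (some i) * w ^ (v (some i)).choose 2) := by
    refine Finset.prod_congr rfl fun i _ => ?_
    by_cases h : i = j
    · subst h
      simp only [Pi.add_apply, Pi.single_eq_same, if_true, Function.update_self,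
        Nat.choose_succ_succ' _ 1, Nat.choose_one_right]
      ring
    · simp [h]
  rw [quadWeight, key, Finset.prod_mul_distrib, Finset.prod_ite_eq' _ _ fun _ => q j, quadWeight]
  simp [mul_assoc]

theorem exists_period_sum_quadWeight {κ R : Type*} [Fintype κ] [DecidableEq κ] [CommRing R]
    [Finite R] (w s : R) (q : κ → R) :
    ∃ N p : ℕ, 0 < p ∧ ∀ n, N ≤ n →
      ∑ σ : Fin (n + p) → Option κ, quadWeight w s q (letterCount σ) =
        ∑ σ : Fin n → Option κ, quadWeight w s q (letterCount σ) := by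
  let S : Set ((Option κ → ℕ) → R) := Set.range fun x : R × (κ → R) => quadWeight w x.1 x.2
  have hS : S.Finite := Set.finite_range _
  have hfin : (Submodule.span R S : Set ((Option κ → ℕ) → R)).Finite := by
    have := Module.Finite.span_of_finite R hS
    have : Finite (Submodule.span R S) := Module.finite_of_finite R
    exact Set.toFinite _
  have hmap : ∀ ψ ∈ Submodule.span R S, appendLetter (Option κ) R ψ ∈ Submodule.span R S := by
    change Submodule.span R S ≤ (Submodule.span R S).comap (appendLetter (Option κ) R)
    rw [Submodule.span_le]
    rintro _ ⟨⟨s, q⟩, rfl⟩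
    have h : appendLetter (Option κ) R (quadWeight w s q) = quadWeight w s q +
        ∑ j, quadWeight w (s * q j) (Function.update q j (q j * w)) := by
      funext v
      simp [appendLetter_apply, Fintype.sum_option, quadWeight_add_single_none,
        quadWeight_add_single_some]
    change appendLetter (Option κ) R (quadWeight w s q) ∈ Submodule.span R S
    rw [h]
    exact add_mem (Submodule.subset_span ⟨(s, q), rfl⟩)
      (sum_mem fun j _ => Submodule.subset_span ⟨(_, _), rfl⟩)
  obtain ⟨N, p, hp, h⟩ := exists_iterate_add_eq_of_finite _ _ hfin hmap
    (Submodule.subset_span ⟨(s, q), rfl⟩)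
  refine ⟨N, p, hp, fun n hn => ?_⟩
  rw [sum_words_letterCount, sum_words_letterCount, h n hn]

/-- Colourings of `W` constant on components, extended by `none` outside of `W`. -/
theorem card_colorings_eq_pow_kappaSub {n b : ℕ} (W : Finset (Fin n))
    (F : Finset (Sym2 (Fin n))) (hF : ∀ e ∈ F, ∀ v : Fin n, v ∈ e → v ∈ W) :
    #{σ : Fin n → Option (Fin b) | ({v | (σ v).isSome} : Finset (Fin n)) = W ∧
      ∀ u v, s(u, v) ∈ F → σ u = σ v} = b ^ kappaSub n W F := by
  classical
  set G := (SimpleGraph.fromEdgeSet (↑F : Set (Sym2 (Fin n)))).induce (↑W : Set (Fin n)) with hG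
  have hcard : b ^ kappaSub n W F = Fintype.card (G.ConnectedComponent → Fin b) := by
    rw [Fintype.card_fun, Fintype.card_fin, kappaSub, Nat.card_eq_fintype_card]
  rw [hcard, ← Finset.card_univ]
  symm
  refine Finset.card_bij (fun f _ v => if h : v ∈ W then
    some (f (G.connectedComponentMk ⟨v, h⟩)) else none) ?_ ?_ ?_
  · intro f _
    rw [Finset.mem_filter]
    refine ⟨Finset.mem_univ _, ?_, fun u v huv => ?_⟩
    · ext v
      by_cases h : v ∈ W <;> simp [h]
    · have hu : u ∈ W := hF _ huv u (by simp)
      have hv : v ∈ W := hF _ huv v (by simp)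
      simp only [hu, hv, dif_pos]
      by_cases h : u = v
      · subst h; rfl
      · have : G.Adj ⟨u, hu⟩ ⟨v, hv⟩ := by simp [hG, huv, h]
        rw [SimpleGraph.ConnectedComponent.sound this.reachable]
  · intro f _ g _ hfg
    funext c
    induction c using SimpleGraph.ConnectedComponent.ind with
    | h v =>
      have := congrFun hfg v.1
      have hv : v.1 ∈ W := v.2
      simpa [hv] using this
  · intro σ hσ
    simp only [Finset.mem_filter, Finset.mem_univ, true_and] at hσ
    obtain ⟨hW, hσ⟩ := hσ
    have hmem (v : Fin n) : v ∈ W ↔ (σ v).isSome := by simp [← hW]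
    have hadj (u v : (↑W : Set (Fin n))) (h : G.Adj u v) : σ u = σ v :=
      hσ _ _ (by simp [hG] at h; exact h.1)
    have hwalk (u v : (↑W : Set (Fin n))) (p : G.Walk u v) : σ u = σ v := by
      induction p with
      | nil => rfl
      | cons h _ ih => exact (hadj _ _ h).trans ih
    refine ⟨SimpleGraph.ConnectedComponent.lift (fun v => (σ v).get ((hmem v).1 v.2))
      fun u v p _ => by simp [hwalk u v p], Finset.mem_univ _, ?_⟩
    funext v
    by_cases h : v ∈ W
    · simp [h]
    · rw [dif_neg h]
      rw [hmem] at h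
      exact (by simpa using h : σ v = none).symm

/-- The edges of the complete graph both of whose ends have the same colour. -/
def monoEdges {n b : ℕ} (σ : Fin n → Option (Fin b)) : Finset (Sym2 (Fin n)) :=
  univ.biUnion fun i : Fin b =>
    ({v | σ v = some i} : Finset (Fin n)).offDiag.image (Function.uncurry Sym2.mk)

theorem mk_mem_monoEdges {n b : ℕ} (σ : Fin n → Option (Fin b)) (u v : Fin n) :
    s(u, v) ∈ monoEdges σ ↔ u ≠ v ∧ (σ u).isSome ∧ σ u = σ v := by
  simp only [monoEdges, Finset.mem_biUnion, Finset.mem_univ, true_and, Finset.mem_image,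
    Finset.mem_offDiag, Finset.mem_filter, Prod.exists, Function.uncurry, Sym2.eq_iff,
    Option.isSome_iff_exists]
  constructor
  · rintro ⟨i, x, y, ⟨hx, hy, hne⟩, ⟨rfl, rfl⟩ | ⟨rfl, rfl⟩⟩
    · exact ⟨hne, ⟨i, hx⟩, hx.trans hy.symm⟩
    · exact ⟨hne.symm, ⟨i, hy⟩, hy.trans hx.symm⟩
  · rintro ⟨hne, ⟨i, hi⟩, h⟩
    exact ⟨i, u, v, ⟨hi, h ▸ hi, hne⟩, Or.inl ⟨rfl, rfl⟩⟩

theorem card_monoEdges {n b : ℕ} (σ : Fin n → Option (Fin b)) :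
    #(monoEdges σ) = ∑ i, (letterCount σ (some i)).choose 2 := by
  rw [monoEdges, Finset.card_biUnion]
  · exact Finset.sum_congr rfl fun i _ => Sym2.card_image_offDiag _
  · intro i _ j _ hij
    rw [Function.onFun, Finset.disjoint_left]
    intro e hi hj
    induction e using Sym2.ind with
    | h u v =>
      simp only [Finset.mem_image, Finset.mem_offDiag, Finset.mem_filter, Prod.exists,
        Function.uncurry, Sym2.eq_iff] at hi hj
      obtain ⟨x, y, ⟨⟨-, hx⟩, ⟨-, hy⟩, -⟩, h⟩ := hi
      obtain ⟨x', y', ⟨⟨-, hx'⟩, ⟨-, hy'⟩, -⟩, h'⟩ := hj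
      have hu : σ u = some i := by rcases h with ⟨rfl, rfl⟩ | ⟨rfl, rfl⟩ <;> assumption
      have hu' : σ u = some j := by rcases h' with ⟨rfl, rfl⟩ | ⟨rfl, rfl⟩ <;> assumption
      exact hij (Option.some_injective _ (hu.symm.trans hu'))

theorem card_isSome_eq_sum_letterCount {n b : ℕ} (σ : Fin n → Option (Fin b)) :
    #{v | (σ v).isSome} = ∑ i, letterCount σ (some i) := by
  have h : ({v | (σ v).isSome} : Finset (Fin n)) =
      univ.biUnion fun i : Fin b => {v | σ v = some i} := by
    ext v
    simp [Option.isSome_iff_exists]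
  rw [h, Finset.card_biUnion]
  · rfl
  · intro i _ j _ hij
    rw [Function.onFun, Finset.disjoint_left]
    intro v hi hj
    simp only [Finset.mem_filter] at hi hj
    exact hij (Option.some_injective _ (hi.2.symm.trans hj.2))

theorem filter_compatible_eq_powerset_monoEdges {n b : ℕ} (σ : Fin n → Option (Fin b)) :
    {F ∈ (⊤ : SimpleGraph (Fin n)).edgeFinset.powerset |
      (∀ e ∈ F, ∀ v : Fin n, v ∈ e → v ∈ ({v | (σ v).isSome} : Finset (Fin n))) ∧
        ∀ u v, s(u, v) ∈ F → σ u = σ v} = (monoEdges σ).powerset := by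
  ext F
  simp only [Finset.mem_filter, Finset.mem_powerset, Finset.mem_univ, true_and]
  constructor
  · rintro ⟨hE, hW, hσ⟩ e he
    induction e using Sym2.ind with
    | h u v =>
      have := hE he
      simp only [SimpleGraph.mem_edgeFinset, SimpleGraph.mem_edgeSet, SimpleGraph.top_adj] at this
      exact (mk_mem_monoEdges σ u v).2 ⟨this, hW _ he u (by simp), hσ u v he⟩
  · intro h
    refine ⟨fun e he => ?_, fun e he v hv => ?_, fun u v he => ?_⟩
    · induction e using Sym2.ind with
      | h u v =>
        simpa using ((mk_mem_monoEdges σ u v).1 (h he)).1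
    · obtain ⟨u, rfl⟩ := hv
      exact ((mk_mem_monoEdges σ v u).1 (h he)).2.1
    · exact ((mk_mem_monoEdges σ u v).1 (h he)).2.2

theorem subgraphCountK_eq_sum_words (n b : ℕ) (a c : ℤ) :
    subgraphCountK n a b c =
      ∑ σ : Fin n → Option (Fin b), quadWeight (c + 1) 1 (fun _ => a) (letterCount σ) := by
  have hterm (σ : Fin n → Option (Fin b)) :
      quadWeight (c + 1) 1 (fun _ => a) (letterCount σ) =
        ∑ F ∈ (monoEdges σ).powerset, a ^ #{v | (σ v).isSome} * c ^ #F := by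
    rw [← Finset.mul_sum, quadWeight, one_mul, Finset.prod_mul_distrib,
      Finset.prod_pow_eq_pow_sum, Finset.prod_pow_eq_pow_sum, ← card_monoEdges,
      ← card_isSome_eq_sum_letterCount, ← Finset.sum_pow_mul_eq_add_pow]
    simp
  rw [subgraphCountK, Finset.powerset_univ,
    ← Finset.sum_fiberwise univ fun σ : Fin n → Option (Fin b) =>
      ({v | (σ v).isSome} : Finset (Fin n))]
  refine Finset.sum_congr rfl fun W _ => ?_
  have hpow : ∀ F ∈ (⊤ : SimpleGraph (Fin n)).edgeFinset.powerset.filter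
        (fun F => ∀ e ∈ F, ∀ v : Fin n, v ∈ e → v ∈ W),
      a ^ #W * (b : ℤ) ^ kappaSub n W F * c ^ #F =
        ∑ σ : Fin n → Option (Fin b) with ({v | (σ v).isSome} : Finset (Fin n)) = W,
          if ∀ u v, s(u, v) ∈ F → σ u = σ v then a ^ #W * c ^ #F else 0 := by
    intro F hF
    rw [← Finset.sum_filter, Finset.filter_filter, Finset.sum_const,
      card_colorings_eq_pow_kappaSub W F (Finset.mem_filter.1 hF).2]
    simp only [nsmul_eq_mul, Nat.cast_pow]
    ring
  rw [Finset.sum_congr rfl hpow, Finset.sum_comm]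
  refine Finset.sum_congr rfl fun σ hσ => ?_
  obtain rfl := (Finset.mem_filter.1 hσ).2
  rw [← Finset.sum_filter, Finset.filter_filter, filter_compatible_eq_powerset_monoEdges, hterm]

theorem cast_quadWeight {κ : Type*} [Fintype κ] (R : Type*) [CommRing R] (w s : ℤ) (q : κ → ℤ)
    (v : Option κ → ℕ) :
    ((quadWeight w s q v : ℤ) : R) = quadWeight (w : R) s (fun i => (q i : R)) v := by
  simp [quadWeight]

theorem subgraphCountK_ultimately_periodic_mod
    (a b c : ℤ) (ha : 0 < a) (hb : 0 < b) (hc : 0 < c) (μ : ℕ) (hμ : 0 < μ) :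
    UltimatelyPeriodicMod μ (fun n => subgraphCountK n a b c) := by
  have : NeZero μ := ⟨hμ.ne'⟩
  lift b to ℕ using hb.le
  obtain ⟨N, p, hp, h⟩ := exists_period_sum_quadWeight (κ := Fin b) ((c + 1 : ℤ) : ZMod μ)
    ((1 : ℤ) : ZMod μ) (fun _ => (a : ZMod μ))
  refine ⟨N, p, hp, fun n hn => ?_⟩
  rw [← ZMod.intCast_eq_intCast_iff]
  simpa only [subgraphCountK_eq_sum_words, Int.cast_sum, cast_quadWeight] using h n hn
end

section
/- Let a : ℕ → ℤ be an integer sequence and μ ≥ 2 an integer. Then a satisfies a linear recurrence relation modulo μ (i.e., there exist k ∈ ℕ and integers c_0, …, c_k such that a(n+1) ≡ Σ_{i=0}^{k} c_i · a(n−i) (mod μ) for all n ≥ k) if and only if a is ultimately periodic modulo μ. -/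
open Finset

/-- A sequence in a finite semiring that satisfies a linear recurrence is ultimately periodic. -/
theorem exists_period_of_linear_recurrence {R : Type*} [Semiring R] [Finite R] (f c : ℕ → R)
    (k : ℕ) (h : ∀ n, k ≤ n → f (n + 1) = ∑ i ∈ Finset.range (k + 1), c i * f (n - i)) :
    ∃ N p : ℕ, 0 < p ∧ ∀ n, N ≤ n → f (n + p) = f n := by
  obtain ⟨x, y, hxy, hwin⟩ :=
    Finite.exists_ne_map_eq_of_infinite (fun (n : ℕ) (i : Fin (k + 1)) => f (n + i))
  wlog hlt : x < y generalizing x y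
  · exact this y x hxy.symm hwin.symm (by omega)
  have key (j : ℕ) : f (y + j) = f (x + j) := by
    induction j using Nat.strong_induction_on with
    | _ j ih =>
      by_cases hj : j < k + 1
      · exact (congrFun hwin ⟨j, hj⟩).symm
      · obtain ⟨l, rfl⟩ : ∃ l, j = l + 1 := ⟨j - 1, by omega⟩
        rw [← add_assoc, ← add_assoc, h (y + l) (by omega), h (x + l) (by omega)]
        refine Finset.sum_congr rfl fun i hi => ?_
        have hi' := Finset.mem_range.mp hi
        rw [Nat.add_sub_assoc (by omega), Nat.add_sub_assoc (by omega), ih (l - i) (by omega)]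
  refine ⟨x, y - x, by omega, fun n hn => ?_⟩
  have hn' := key (n - x)
  rwa [show y + (n - x) = n + (y - x) by omega, show x + (n - x) = n by omega] at hn'

theorem linear_recurrence_mod_iff_ultimately_periodic
    (a : ℕ → ℤ) (μ : ℕ) (hμ : 2 ≤ μ) :
    (∃ (k : ℕ) (c : ℕ → ℤ), ∀ n : ℕ, k ≤ n →
        a (n + 1) ≡ ∑ i ∈ Finset.range (k + 1), c i * a (n - i) [ZMOD (μ : ℤ)]) ↔
      UltimatelyPeriodicMod μ a := by
  constructor
  · rintro ⟨k, c, h⟩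
    have : NeZero μ := ⟨by omega⟩
    obtain ⟨N, p, hp, hper⟩ := exists_period_of_linear_recurrence
      (fun n => (a n : ZMod μ)) (fun i => (c i : ZMod μ)) k fun n hn => by
        have hn' := (ZMod.intCast_eq_intCast_iff _ _ μ).mpr (h n hn)
        push_cast at hn'
        exact hn'
    exact ⟨N, p, hp, fun n hn => (ZMod.intCast_eq_intCast_iff _ _ μ).mp (hper n hn)⟩
  · rintro ⟨N, p, hp, h⟩
    refine ⟨N + p - 1, fun i => if i = p - 1 then 1 else 0, fun n hn => ?_⟩
    have hmem : p - 1 < N + p - 1 + 1 := by omega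
    have hn' := h (n - (p - 1)) (by omega)
    rw [show n - (p - 1) + p = n + 1 by omega] at hn'
    simpa [ite_mul, Finset.sum_ite_eq', hmem] using hn'
end

section
/- For every integer n ≥ 2: if n is a power of 2, then b_2(n) is odd, and otherwise b_2(n) is even. -/
open Finset

/-- `b2 n` is the number of labeled graphs on `{1, …, n}` which are the disjoint
union of two equal-sized cliques: `(1/2)·C(2m, m)` if `n = 2m`, and `0` if `n` is odd. -/
def b2 (n : ℕ) : ℕ :=
  if Even n then Nat.choose n (n / 2) / 2 else 0

theorem choose_two_mul_add_two (j : ℕ) :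
    (2 * j + 2).choose (j + 1) = 2 * (2 * j + 1).choose (j + 1) := by
  rw [Nat.choose_succ_succ' (2 * j + 1) j, ← Nat.choose_symm_half j, ← two_mul]

theorem odd_choose_two_mul_add_one_iff (j : ℕ) :
    Odd ((2 * j + 1).choose (j + 1)) ↔ ∃ k : ℕ, j + 1 = 2 ^ k := by
  induction j using Nat.strong_induction_on with
  | _ j ih =>
    have lucas : Odd ((2 * j + 1).choose (j + 1)) ↔ Odd (j.choose ((j + 1) / 2)) := by
      have : Fact (Nat.Prime 2) := ⟨Nat.prime_two⟩
      have h := Choose.choose_modEq_choose_mod_mul_choose_div_nat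
        (n := 2 * j + 1) (k := j + 1) (p := 2)
      have h1 : (2 * j + 1) % 2 = 1 := by omega
      have h2 : (2 * j + 1) / 2 = j := by omega
      have h3 : Nat.choose 1 ((j + 1) % 2) = 1 := by
        rcases Nat.mod_two_eq_zero_or_one (j + 1) with h | h <;> simp [h]
      rw [h1, h2, h3, one_mul] at h
      rw [Nat.odd_iff, Nat.odd_iff, h]
    rw [lucas]
    obtain ⟨i, rfl | rfl⟩ := Nat.even_or_odd' j
    · rw [show (2 * i + 1) / 2 = i by omega]
      rcases i with _ | i
      · simpa using ⟨0, rfl⟩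
      · rw [show 2 * (i + 1) = 2 * i + 2 by ring, choose_two_mul_add_two]
        refine iff_of_false (by simp) ?_
        rintro ⟨_ | k, hk⟩
        · simp at hk
        · rw [pow_succ] at hk
          omega
    · rw [show (2 * i + 1 + 1) / 2 = i + 1 by omega, ih i (by omega)]
      constructor
      · rintro ⟨k, hk⟩
        exact ⟨k + 1, by rw [pow_succ]; omega⟩
      · rintro ⟨_ | k, hk⟩
        · simp at hk
        · exact ⟨k, by rw [pow_succ] at hk; omega⟩

theorem b2_two_mul_add_two (j : ℕ) : b2 (2 * j + 2) = (2 * j + 1).choose (j + 1) := by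
  have he : Even (2 * j + 2) := ⟨j + 1, by ring⟩
  rw [b2, if_pos he, show (2 * j + 2) / 2 = j + 1 by omega, choose_two_mul_add_two]
  omega

theorem b2_parity (n : ℕ) (hn : 2 ≤ n) :
    ((∃ k : ℕ, n = 2 ^ k) → Odd (b2 n)) ∧ (¬ (∃ k : ℕ, n = 2 ^ k) → Even (b2 n)) := by
  suffices h : Odd (b2 n) ↔ ∃ k : ℕ, n = 2 ^ k from
    ⟨h.mpr, fun hk => Nat.not_odd_iff_even.mp (mt h.mp hk)⟩
  obtain ⟨m, rfl | rfl⟩ := Nat.even_or_odd' n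
  · obtain ⟨j, rfl⟩ : ∃ j, m = j + 1 := ⟨m - 1, by omega⟩
    rw [show 2 * (j + 1) = 2 * j + 2 by ring, b2_two_mul_add_two, odd_choose_two_mul_add_one_iff]
    constructor
    · rintro ⟨k, hk⟩
      exact ⟨k + 1, by rw [pow_succ]; omega⟩
    · rintro ⟨_ | k, hk⟩
      · simp at hk
      · exact ⟨k, by rw [pow_succ] at hk; omega⟩
  · refine iff_of_false (by simp [b2]) ?_
    rintro ⟨_ | k, hk⟩
    · omega
    · rw [pow_succ] at hk
      omega
end

section
/- The sequence n ↦ b_2(n) is not ultimately periodic modulo 2; that is, there are no N ≥ 0 and p ≥ 1 such that b_2(n+p) ≡ b_2(n) (mod 2) for all n ≥ N. -/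
open Finset

theorem b2_two_mul {m : ℕ} (hm : 0 < m) : b2 (2 * m) = (2 * m - 1).choose m := by
  obtain ⟨j, rfl⟩ : ∃ j, m = j + 1 := ⟨m - 1, by lia⟩
  have hchoose : (2 * j + 2).choose (j + 1) = 2 * (2 * j + 1).choose (j + 1) := by
    rw [Nat.choose_succ_succ', Nat.choose_symm_half, ← two_mul]
  simp only [b2, even_two_mul, if_true, Nat.mul_div_cancel_left _ two_pos]
  rw [show 2 * (j + 1) = 2 * j + 2 by ring, hchoose, Nat.mul_div_cancel_left _ two_pos]
  rfl

theorem b2_of_odd {n : ℕ} (hn : Odd n) : b2 n = 0 :=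
  if_neg (Nat.not_even_iff_odd.mpr hn)

theorem odd_b2_double_iff {j : ℕ} (hj : 0 < j) : Odd (b2 (2 * (2 * j))) ↔ Odd (b2 (2 * j)) := by
  rw [b2_two_mul (by lia), b2_two_mul hj]
  have lucas := Choose.choose_modEq_choose_mod_mul_choose_div_nat
    (n := 2 * (2 * j) - 1) (k := 2 * j) (p := 2)
  rw [show (2 * (2 * j) - 1) % 2 = 1 by lia, show 2 * j % 2 = 0 by lia,
    show (2 * (2 * j) - 1) / 2 = 2 * j - 1 by lia, show 2 * j / 2 = j by lia,
    Nat.choose_zero_right, one_mul] at lucas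
  rw [Nat.odd_iff, Nat.odd_iff, lucas]

theorem even_b2_two_mul_odd {j : ℕ} (hj : 0 < j) : Even (b2 (2 * (2 * j + 1))) := by
  rw [b2_two_mul (by lia)]
  have lucas := Choose.choose_modEq_choose_mod_mul_choose_div_nat
    (n := 2 * (2 * j + 1) - 1) (k := 2 * j + 1) (p := 2)
  rw [show (2 * (2 * j + 1) - 1) % 2 = 1 by lia, show (2 * j + 1) % 2 = 1 by lia,
    show (2 * (2 * j + 1) - 1) / 2 = 2 * j by lia, show (2 * j + 1) / 2 = j by lia,
    Nat.choose_self, one_mul] at lucas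
  rw [Nat.even_iff, lucas]
  exact Nat.mod_eq_zero_of_dvd (Nat.two_dvd_centralBinom_of_one_le hj)

/-- `b2 (2 * m)` is odd exactly when `m` is a power of two. -/
theorem odd_b2_two_mul_iff {m : ℕ} (hm : 0 < m) : Odd (b2 (2 * m)) ↔ ∃ k, m = 2 ^ k := by
  constructor
  · induction m using Nat.strong_induction_on with
    | _ m ih =>
      intro hodd
      obtain ⟨j, rfl | rfl⟩ := Nat.even_or_odd' m
      · obtain ⟨k, hk⟩ := ih j (by lia) (by lia) ((odd_b2_double_iff (by lia)).mp hodd)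
        exact ⟨k + 1, by rw [hk, pow_succ']⟩
      · rcases j.eq_zero_or_pos with rfl | hj
        · exact ⟨0, rfl⟩
        · exact absurd hodd (Nat.not_odd_iff_even.mpr (even_b2_two_mul_odd hj))
  · rintro ⟨k, rfl⟩
    induction k with
    | zero => decide
    | succ k ih =>
      rw [pow_succ', odd_b2_double_iff (by positivity)]
      exact ih (by positivity)

theorem b2_not_ultimately_periodic_mod_two :
    ¬ UltimatelyPeriodicMod 2 (fun n => (b2 n : ℤ)) := by
  rintro ⟨N, p, hp, hper⟩
  have hlarge : N + p < 2 ^ (N + p) := Nat.lt_two_pow_self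
  have hodd : Odd (b2 (2 * 2 ^ (N + p))) := (odd_b2_two_mul_iff (by positivity)).mpr ⟨_, rfl⟩
  have hcongr : b2 (2 * 2 ^ (N + p) + p) ≡ b2 (2 * 2 ^ (N + p)) [MOD 2] :=
    Int.natCast_modEq_iff.mp (hper _ (by lia))
  have hodd' : Odd (b2 (2 * 2 ^ (N + p) + p)) := by
    rw [Nat.odd_iff] at hodd ⊢
    exact Eq.trans hcongr hodd
  obtain ⟨q, hq | hq⟩ := Nat.even_or_odd' p
  · rw [show 2 * 2 ^ (N + p) + p = 2 * (2 ^ (N + p) + q) by lia,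
      odd_b2_two_mul_iff (by positivity)] at hodd'
    obtain ⟨k, hk⟩ := hodd'
    have hlt : N + p < k := (Nat.pow_lt_pow_iff_right one_lt_two).mp (by lia)
    have hle : 2 ^ (N + p + 1) ≤ 2 ^ k := Nat.pow_le_pow_right two_pos hlt
    rw [pow_succ] at hle
    lia
  · rw [b2_of_odd ⟨2 ^ (N + p) + q, by lia⟩] at hodd'
    exact absurd hodd' (by decide)
end

section
/- For every natural number a and every positive integer μ, the integer sequence n ↦ He_n(a) is ultimately periodic modulo μ. -/
open Finset Polynomial

/-- The probabilist's Hermite polynomials: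
`He 0 = 1`, `He 1 = X`, `He (n+2) = X · He (n+1) - (n+1) · He n`. -/
noncomputable def He : ℕ → Polynomial ℤ
  | 0 => 1
  | 1 => Polynomial.X
  | (n + 2) => Polynomial.X * He (n + 1) - Polynomial.C ((n : ℤ) + 1) * He n

/-- An orbit of a self-map of a finite type is ultimately periodic. -/
theorem exists_period_of_succ_eq {S : Type*} [Finite S] {s : ℕ → S} {T : S → S}
    (hs : ∀ n, s (n + 1) = T (s n)) :
    ∃ N p : ℕ, 0 < p ∧ ∀ n : ℕ, N ≤ n → s (n + p) = s n := by
  obtain ⟨i, j, hij, h⟩ : ∃ i j : ℕ, i < j ∧ s i = s j := by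
    obtain ⟨i, j, hne, h⟩ := Finite.exists_ne_map_eq_of_infinite s
    rcases hne.lt_or_gt with hlt | hlt
    exacts [⟨i, j, hlt, h⟩, ⟨j, i, hlt, h.symm⟩]
  refine ⟨i, j - i, Nat.sub_pos_of_lt hij, fun n hn => ?_⟩
  induction n, hn using Nat.le_induction with
  | base => rw [Nat.add_sub_cancel' hij.le, h]
  | succ n _ ih => rw [Nat.add_right_comm, hs, hs, ih]

theorem eval_He_add_two (n : ℕ) (a : ℤ) :
    (He (n + 2)).eval a = a * (He (n + 1)).eval a - (n + 1) * (He n).eval a := by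
  rw [He]
  simp

theorem hermite_eval_ultimately_periodic_mod (a : ℕ) (μ : ℕ) (hμ : 0 < μ) :
    UltimatelyPeriodicMod μ (fun n => (He n).eval (a : ℤ)) := by
  have : NeZero μ := ⟨hμ.ne'⟩
  obtain ⟨N, p, hp, h⟩ := exists_period_of_succ_eq
    (s := fun n : ℕ => ((n : ZMod μ), (((He n).eval (a : ℤ) : ℤ) : ZMod μ),
      (((He (n + 1)).eval (a : ℤ) : ℤ) : ZMod μ)))
    (T := fun x => (x.1 + 1, x.2.2, (a : ZMod μ) * x.2.2 - (x.1 + 1) * x.2.1))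
    (fun n => by simp [eval_He_add_two])
  refine ⟨N, p, hp, fun n hn => ?_⟩
  rw [← ZMod.intCast_eq_intCast_iff]
  exact congrArg (fun x => x.2.1) (h n hn)
end
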